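/- Let (A, [·,·], ∧) be a Gerstenhaber algebra, E the graded vector space with E_{−k} := A^k, 𝒩_k(P_1,…,P_k) := P_1∧⋯∧P_k, l_1 := 0, l_2(P_1,P_2) := (−1)^{|P_1|}[P_1,P_2], and l_i := ι_{l_2}𝒩_{i−1} for i > 2. Then for any real coefficients (b_i)_{i≥1} and (a_i)_{i≥1}, the form 𝒩 := Σ_{i≥1} b_i 𝒩_i is weak Nijenhuis with respect to the L∞-structure μ = Σ_{i≥1} a_i l_i, i.e. [μ, [𝒩, [𝒩, μ]_RN]_RN]_RN = 0. -/

import Mathlib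

open Finset

section Framework

variable {V : Type*} [AddCommGroup V] [Module ℝ V]

/-- The Koszul sign `ε(σ)` of a permutation `σ` acting on homogeneous elements whose
degrees are given by `d`. -/
def koszulSign {n : ℕ} (d : Fin n → ℤ) (σ : Equiv.Perm (Fin n)) : ℤ :=
  ∏ p ∈ Finset.univ.filter (fun p : Fin n × Fin n => p.1 < p.2 ∧ σ p.2 < σ p.1),
    (-1 : ℤ) ^ (d (σ p.1) * d (σ p.2)).natAbs

/-- The `(k, n-k)`-unshuffles: permutations of `Fin n` which are increasing on the
first `k` indices and on the remaining ones. -/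
def unshuffles (k n : ℕ) : Finset (Equiv.Perm (Fin n)) :=
  Finset.univ.filter (fun σ =>
    (∀ i j : Fin n, i < j → (j : ℕ) < k → σ i < σ j) ∧
    (∀ i j : Fin n, i < j → k ≤ (i : ℕ) → σ i < σ j))

/-- A (raw) vector valued `k`-form on the graded vector space with grading `𝒢`:
it assigns, to homogeneous elements of degrees `d 0, …, d (k-1)`, an element of `V`. -/
abbrev GForm (𝒢 : ℤ → Submodule ℝ V) (k : ℕ) : Type _ :=
  (d : Fin k → ℤ) → ((i : Fin k) → 𝒢 (d i)) → V

/-- Transport of a vector valued form along an equality of arities. -/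
def castForm {𝒢 : ℤ → Submodule ℝ V} {m n : ℕ} (h : m = n) (K : GForm 𝒢 m) : GForm 𝒢 n :=
  h ▸ K

variable (𝒢 : ℤ → Submodule ℝ V)

/-- Projection on the homogeneous component of degree `i`. -/
def prj [DirectSum.Decomposition 𝒢] (i : ℤ) (v : V) : 𝒢 i :=
  DirectSum.decompose 𝒢 v i

/-- Insertion of a `k`-form `K` of degree `δK` into an `(l+1)`-form `L`:
`ι_K L (X_1,…,X_{k+l}) = Σ_{σ ∈ Sh(k,l)} ε(σ) L(K(X_{σ(1)},…,X_{σ(k)}), X_{σ(k+1)},…)`. -/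
def insertPos [DirectSum.Decomposition 𝒢] {k l : ℕ} (δK : ℤ) (K : GForm 𝒢 k)
    (L : GForm 𝒢 (l + 1)) : GForm 𝒢 (k + l) := fun d x =>
  ∑ σ ∈ unshuffles k (k + l),
    koszulSign d σ •
      L (Fin.cons ((∑ i : Fin k, d (σ (Fin.castAdd l i))) + δK)
          (fun j : Fin l => d (σ (Fin.natAdd k j))))
        (Fin.cons
          (prj 𝒢 ((∑ i : Fin k, d (σ (Fin.castAdd l i))) + δK)
            (K (fun i => d (σ (Fin.castAdd l i))) (fun i => x (σ (Fin.castAdd l i)))))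
          (fun j : Fin l => x (σ (Fin.natAdd k j))))

/-- Insertion operator `ι_K L` of a `k`-form of degree `δK` into an `l`-form. -/
def insertionOp [DirectSum.Decomposition 𝒢] {k l : ℕ} (δK : ℤ) (K : GForm 𝒢 k) :
    GForm 𝒢 l → GForm 𝒢 (k + l - 1) :=
  match l with
  | 0 => fun _ => fun _ _ => 0
  | _ + 1 => fun L => insertPos 𝒢 δK K L

/-- A formal sum of vector valued forms of all arities. -/
abbrev MultiForm : Type _ := (k : ℕ) → GForm 𝒢 k

/-- A single `k`-form seen as a formal sum concentrated in arity `k`. -/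
def singleF (k : ℕ) (K : GForm 𝒢 k) : MultiForm 𝒢 :=
  fun n => if h : n = k then castForm h.symm K else 0

/-- The Richardson–Nijenhuis bracket `[K,L] = ι_K L - (-1)^{K̄ L̄} ι_L K` of formal
sums of forms `K` (of degree `δK`) and `L` (of degree `δL`), computed aritywise. -/
def rnBracketM [DirectSum.Decomposition 𝒢] (δK δL : ℤ) (K L : MultiForm 𝒢) : MultiForm 𝒢 :=
  fun n =>
    (∑ p ∈ (Finset.range (n + 2)).attach,
      castForm (by have := Finset.mem_range.mp p.2; omega)
        (insertionOp 𝒢 δK (K p.1) (L (n + 1 - p.1))))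
    - ((-1 : ℤ) ^ (δK * δL).natAbs) •
      (∑ p ∈ (Finset.range (n + 2)).attach,
        castForm (by have := Finset.mem_range.mp p.2; omega)
          (insertionOp 𝒢 δL (L p.1) (K (n + 1 - p.1))))

/-- `K` is a graded symmetric vector valued `k`-form of degree `δ`. -/
structure IsSymFormOfDeg {k : ℕ} (δ : ℤ) (K : GForm 𝒢 k) : Prop where
  mem_grading : ∀ (d : Fin k → ℤ) (x : (i : Fin k) → 𝒢 (d i)), K d x ∈ 𝒢 ((∑ i, d i) + δ)
  map_add : ∀ (d : Fin k → ℤ) (x : (i : Fin k) → 𝒢 (d i)) (i : Fin k) (a b : 𝒢 (d i)),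
    K d (Function.update x i (a + b)) = K d (Function.update x i a) + K d (Function.update x i b)
  map_smul : ∀ (d : Fin k → ℤ) (x : (i : Fin k) → 𝒢 (d i)) (i : Fin k) (c : ℝ) (a : 𝒢 (d i)),
    K d (Function.update x i (c • a)) = c • K d (Function.update x i a)
  symm : ∀ (d : Fin k → ℤ) (σ : Equiv.Perm (Fin k)) (x : (i : Fin k) → 𝒢 (d i)),
    K (d ∘ σ) (fun i => x (σ i)) = koszulSign d σ • K d x

/-- The `L_∞` identities for a family `(l_i)` of symmetric vector valued forms of degree 1:
for each `n`, `Σ_{i+j=n+1} Σ_{σ ∈ Sh(i,j-1)} ε(σ) l_j (l_i (X_σ(1),…), X_…) = 0`. -/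
def LInftyIdentity [DirectSum.Decomposition 𝒢] (l : MultiForm 𝒢) : Prop :=
  ∀ n : ℕ,
    (∑ p ∈ (Finset.range (n + 2)).attach,
      castForm (by have := Finset.mem_range.mp p.2; omega)
        (insertionOp 𝒢 1 (l p.1) (l (n + 1 - p.1)))) = (0 : GForm 𝒢 n)

end Framework

section Gerstenhaber

variable {V : Type*} [AddCommGroup V] [Module ℝ V]

/-- A Gerstenhaber algebra structure on a graded vector space `(V, 𝒜)`: a graded
commutative associative product `wedge` together with a graded Lie bracket on the
shifted space which is a degree `i` derivation in each argument. -/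
structure Gerstenhaber (𝒜 : ℤ → Submodule ℝ V) : Type _ where
  wedge : V →ₗ[ℝ] V →ₗ[ℝ] V
  bracket : V →ₗ[ℝ] V →ₗ[ℝ] V
  wedge_mem : ∀ (i j : ℤ) (x y : V), x ∈ 𝒜 i → y ∈ 𝒜 j → wedge x y ∈ 𝒜 (i + j)
  bracket_mem : ∀ (i j : ℤ) (x y : V), x ∈ 𝒜 i → y ∈ 𝒜 j → bracket x y ∈ 𝒜 (i + j - 1)
  wedge_assoc : ∀ x y z, wedge (wedge x y) z = wedge x (wedge y z)
  wedge_comm : ∀ (i j : ℤ) (x y : V), x ∈ 𝒜 i → y ∈ 𝒜 j →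
    wedge x y = ((-1 : ℤ) ^ (i * j).natAbs) • wedge y x
  bracket_antisymm : ∀ (i j : ℤ) (x y : V), x ∈ 𝒜 i → y ∈ 𝒜 j →
    bracket x y = -(((-1 : ℤ) ^ ((i - 1) * (j - 1)).natAbs) • bracket y x)
  jacobi : ∀ (i j : ℤ) (x y z : V), x ∈ 𝒜 i → y ∈ 𝒜 j →
    bracket x (bracket y z) = bracket (bracket x y) z
      + ((-1 : ℤ) ^ ((i - 1) * (j - 1)).natAbs) • bracket y (bracket x z)
  leibniz : ∀ (i j : ℤ) (x y z : V), x ∈ 𝒜 i → y ∈ 𝒜 j →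
    bracket x (wedge y z) = wedge (bracket x y) z
      + ((-1 : ℤ) ^ ((i - 1) * j).natAbs) • wedge y (bracket x z)

variable {𝒜 : ℤ → Submodule ℝ V}

/-- The grading of the graded vector space `E` with `E_{-k} := A^k`. -/
abbrev negG (𝒜 : ℤ → Submodule ℝ V) : ℤ → Submodule ℝ V := fun i => 𝒜 (-i)

/-- Iterated wedge product of `k+1` elements. -/
def wedgeAll (G : Gerstenhaber 𝒜) : {k : ℕ} → (Fin (k + 1) → V) → V
  | 0, x => x 0
  | _ + 1, x => G.wedge (x 0) (wedgeAll G (fun i => x i.succ))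

/-- The symmetric vector valued `k`-form `𝒩_k (P_1, …, P_k) := P_1 ∧ ⋯ ∧ P_k`. -/
def mathcalN (G : Gerstenhaber 𝒜) (𝒢 : ℤ → Submodule ℝ V) : (k : ℕ) → GForm 𝒢 k
  | 0 => fun _ _ => 0
  | _ + 1 => fun _ x => wedgeAll G (fun i => (x i : V))

/-- The symmetric vector valued 2-form `l_2 (P_1, P_2) := (-1)^{|P_1|} [P_1, P_2]`. -/
def l2G (G : Gerstenhaber 𝒜) (𝒢 : ℤ → Submodule ℝ V) : GForm 𝒢 2 :=
  fun d x => ((-1 : ℤ) ^ (d 0).natAbs) • G.bracket (x 0) (x 1)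

/-- The family `l_1 := 0`, `l_2`, and `l_i := ι_{l_2} 𝒩_{i-1}` for `i > 2`. -/
def lFormsG (G : Gerstenhaber 𝒜) (𝒢 : ℤ → Submodule ℝ V) [DirectSum.Decomposition 𝒢] :
    (i : ℕ) → GForm 𝒢 i
  | 0 => 0
  | 1 => 0
  | 2 => l2G G 𝒢
  | i + 3 => castForm (by omega) (insertionOp 𝒢 1 (l2G G 𝒢) (mathcalN G 𝒢 (i + 2)))

end Gerstenhaber

section KoszulSplitting

/-- The sign `(-1)^i`. -/
noncomputable def sg (i : ℤ) : ℝ := (-1 : ℝ) ^ i.natAbs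

lemma zsmul_eq_sg_smul {M : Type*} [AddCommGroup M] [Module ℝ M] (i : ℤ) (v : M) :
    ((-1 : ℤ) ^ i.natAbs) • v = sg i • v := by
  rw [← Int.cast_smul_eq_zsmul ℝ]; simp [sg]

lemma sg_eq_ite (i : ℤ) : sg i = if Even i then 1 else -1 := by
  unfold sg
  split_ifs with h
  · exact (Int.natAbs_even.mpr h).neg_one_pow
  · exact (Int.natAbs_odd.mpr (Int.not_even_iff_odd.mp h)).neg_one_pow

@[simp] lemma sg_zero : sg 0 = 1 := by simp [sg]

lemma sg_add (i j : ℤ) : sg (i + j) = sg i * sg j := by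
  simp only [sg_eq_ite, Int.even_add]
  by_cases hi : Even i <;> by_cases hj : Even j <;> simp [hi, hj]

lemma sg_congr {i j : ℤ} (h : Even i ↔ Even j) : sg i = sg j := by
  simp only [sg_eq_ite, h]

lemma sg_of_even {i : ℤ} (h : Even i) : sg i = 1 := by rw [sg_eq_ite, if_pos h]

lemma sg_mul_self (i : ℤ) : sg i * sg i = 1 := by
  rw [sg_eq_ite]; split_ifs <;> norm_num

variable {H M : Type*} [AddCommGroup M] [Module ℝ M] (deg : H → ℤ)

/-- The total degree of a list of homogeneous elements. -/
def listDeg (A : List H) : ℤ := (A.map deg).sum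

@[simp] lemma listDeg_nil : listDeg deg [] = 0 := rfl

@[simp] lemma listDeg_cons (x : H) (A : List H) :
    listDeg deg (x :: A) = deg x + listDeg deg A := by simp [listDeg]

/-- The sum, with Koszul signs, of `F A B` over all splittings of a list into complementary
sublists `A` and `B`. -/
noncomputable def splitSum : List H → (List H → List H → M) → M
  | [], F => F [] []
  | x :: xs, F => splitSum xs (fun A B => F (x :: A) B)
      + splitSum xs (fun A B => sg (deg x * listDeg deg A) • F A (x :: B))

variable {deg}

lemma splitSum_congr {xs : List H} {F F' : List H → List H → M}
    (h : ∀ A B, A.length + B.length = xs.length → F A B = F' A B) :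
    splitSum deg xs F = splitSum deg xs F' := by
  induction xs generalizing F F' with
  | nil => exact h _ _ rfl
  | cons x xs ih =>
    simp only [splitSum]
    congr 1
    · exact ih fun A B hl => h _ _ (by simp; omega)
    · exact ih fun A B hl => by rw [h _ _ (by simp; omega)]

lemma splitSum_add (xs : List H) (F F' : List H → List H → M) :
    splitSum deg xs (fun A B => F A B + F' A B) = splitSum deg xs F + splitSum deg xs F' := by
  induction xs generalizing F F' with
  | nil => rfl
  | cons x xs ih => simp only [splitSum, smul_add, ih]; abel

lemma splitSum_map {M' : Type*} [AddCommGroup M'] [Module ℝ M'] (φ : M →ₗ[ℝ] M')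
    (xs : List H) (F : List H → List H → M) :
    splitSum deg xs (fun A B => φ (F A B)) = φ (splitSum deg xs F) := by
  induction xs generalizing F with
  | nil => rfl
  | cons x xs ih => simp only [splitSum, ← map_smul, ih, map_add]

lemma splitSum_smul (c : ℝ) (xs : List H) (F : List H → List H → M) :
    splitSum deg xs (fun A B => c • F A B) = c • splitSum deg xs F :=
  splitSum_map (c • LinearMap.id) xs F

lemma splitSum_zero (xs : List H) : splitSum deg xs (fun _ _ => (0 : M)) = 0 := by
  simpa using splitSum_smul (deg := deg) 0 xs (fun _ _ => (0 : M))

lemma splitSum_eq_zero {xs : List H} {F : List H → List H → M}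
    (h : ∀ A B, A.length + B.length = xs.length → F A B = 0) : splitSum deg xs F = 0 :=
  (splitSum_congr h).trans (splitSum_zero xs)

lemma splitSum_left_nil {xs : List H} {F : List H → List H → M}
    (h : ∀ A B, A ≠ [] → F A B = 0) : splitSum deg xs F = F [] xs := by
  induction xs generalizing F with
  | nil => rfl
  | cons x xs ih =>
    rw [splitSum, splitSum_eq_zero (fun A B _ => h _ _ (by simp)), ih]
    · simp
    · intro A B hA; simp [h A _ hA]

lemma splitSum_right_nil {xs : List H} {F : List H → List H → M}
    (h : ∀ A B, B ≠ [] → F A B = 0) : splitSum deg xs F = F xs [] := by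
  induction xs generalizing F with
  | nil => rfl
  | cons x xs ih =>
    rw [splitSum, splitSum_eq_zero (F := fun A B => sg _ • F A (x :: B))
      (fun A B _ => by simp [h A (x :: B)]), ih]
    · simp
    · intro A B hA; simp [h _ _ hA]

lemma splitSum_comm (xs : List H) (F : List H → List H → M) :
    splitSum deg xs F
      = splitSum deg xs (fun A B => sg (listDeg deg A * listDeg deg B) • F B A) := by
  induction xs generalizing F with
  | nil => simp [splitSum]
  | cons x xs ih =>
    simp only [splitSum]
    rw [ih, ih (fun A B => sg _ • F A (x :: B)), add_comm]
    congr 1 <;> congr 1 <;> ext A B <;>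
      simp only [smul_smul, listDeg_cons, add_mul, mul_add, sg_add] <;> congr 1
    · ring
    · rw [mul_comm (listDeg deg A) (deg x), ← mul_assoc, sg_mul_self, one_mul]

lemma splitSum_congr_deg {xs : List H} {F F' : List H → List H → M}
    (h : ∀ A B, listDeg deg A + listDeg deg B = listDeg deg xs → F A B = F' A B) :
    splitSum deg xs F = splitSum deg xs F' := by
  induction xs generalizing F F' with
  | nil => exact h _ _ rfl
  | cons x xs ih =>
    simp only [splitSum]
    congr 1
    · exact ih fun A B hl => h _ _ (by simp; omega)
    · exact ih fun A B hl => by rw [h _ _ (by simp; omega)]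

lemma splitSum_assoc (xs : List H) (F : List H → List H → List H → M) :
    splitSum deg xs (fun D C => splitSum deg D (fun A B => F A B C))
      = splitSum deg xs (fun A D => splitSum deg D (fun B C => F A B C)) := by
  induction xs generalizing F with
  | nil => rfl
  | cons x xs ih =>
    have key : splitSum deg xs (fun D C => sg (deg x * listDeg deg D) •
          splitSum deg D (fun A B => F A B (x :: C)))
        = splitSum deg xs (fun D C => splitSum deg D (fun A B =>
          sg (deg x * (listDeg deg A + listDeg deg B)) • F A B (x :: C))) := by
      congr 1; ext D C
      rw [← splitSum_smul]
      exact splitSum_congr_deg fun A B h => by rw [h]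
    simp only [splitSum, splitSum_add]
    rw [key]
    simp only [ih, smul_add, ← splitSum_smul, smul_smul, mul_add, sg_add, splitSum_add,
      add_assoc]

end KoszulSplitting

section UnitalGerstenhaber

variable {V : Type*} [AddCommGroup V] [Module ℝ V] {𝒜 : ℤ → Submodule ℝ V}

/-- `e` is a unit of the Gerstenhaber algebra `G`. -/
structure Gerstenhaber.HasUnit (G : Gerstenhaber 𝒜) (e : V) : Prop where
  mem : e ∈ 𝒜 0
  unit_wedge : ∀ x, G.wedge e x = x
  wedge_unit : ∀ x, G.wedge x e = x
  bracket_unit : ∀ x, G.bracket x e = 0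
  unit_bracket : ∀ x, G.bracket e x = 0

/-- The bracket twisted by the sign of the degree `i` of its first argument. -/
noncomputable def l2Tw (G : Gerstenhaber 𝒜) (i : ℤ) : V →ₗ[ℝ] V →ₗ[ℝ] V := sg i • G.bracket

variable {G : Gerstenhaber 𝒜} {i j k : ℤ} {x y z : V}

lemma l2Tw_apply : l2Tw G i x y = sg i • G.bracket x y := rfl

lemma mem_of_eq {i j : ℤ} (hx : x ∈ 𝒜 i) (h : i = j) : x ∈ 𝒜 j := h ▸ hx

lemma wedge_mem_neg (hx : x ∈ 𝒜 (-i)) (hy : y ∈ 𝒜 (-j)) : G.wedge x y ∈ 𝒜 (-(i + j)) :=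
  mem_of_eq (G.wedge_mem _ _ _ _ hx hy) (by ring)

lemma l2Tw_mem (hx : x ∈ 𝒜 (-i)) (hy : y ∈ 𝒜 (-j)) (k : ℤ) :
    l2Tw G k x y ∈ 𝒜 (-(i + j + 1)) :=
  Submodule.smul_mem _ _ (mem_of_eq (G.bracket_mem _ _ _ _ hx hy) (by ring))

lemma wedge_comm_sg (hx : x ∈ 𝒜 (-i)) (hy : y ∈ 𝒜 (-j)) :
    G.wedge x y = sg (i * j) • G.wedge y x := by
  rw [G.wedge_comm _ _ _ _ hx hy, zsmul_eq_sg_smul]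
  congr 2; ring

lemma l2Tw_symm (hx : x ∈ 𝒜 (-i)) (hy : y ∈ 𝒜 (-j)) :
    l2Tw G i x y = sg (i * j) • l2Tw G j y x := by
  rw [l2Tw_apply, G.bracket_antisymm _ _ _ _ hx hy, zsmul_eq_sg_smul, l2Tw_apply, ← neg_one_smul ℝ]
  simp only [smul_smul]
  congr 1
  rw [show (-1 : ℝ) = sg 1 by simp [sg]]
  simp only [← sg_add]
  apply sg_congr
  simp only [Int.even_add, Int.even_sub, Int.even_mul, even_neg, Int.not_even_one]
  tauto

lemma l2Tw_wedge (hx : x ∈ 𝒜 (-i)) (hy : y ∈ 𝒜 (-j)) (k : ℤ) :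
    l2Tw G k x (G.wedge y z)
      = G.wedge (l2Tw G k x y) z + sg ((i + 1) * j) • G.wedge y (l2Tw G k x z) := by
  simp only [l2Tw_apply]
  rw [G.leibniz _ _ _ _ _ hx hy, zsmul_eq_sg_smul, map_smul, map_smul, LinearMap.smul_apply,
    smul_add, smul_comm]
  congr 3
  ring

lemma l2Tw_wedge_left (hx : x ∈ 𝒜 (-i)) (hy : y ∈ 𝒜 (-j)) (hz : z ∈ 𝒜 (-k)) :
    l2Tw G (i + j) (G.wedge x y) z = sg i • G.wedge x (l2Tw G j y z)
      + sg (j * (i + 1)) • G.wedge y (l2Tw G i x z) := by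
  rw [l2Tw_symm (wedge_mem_neg hx hy) hz, l2Tw_wedge hz hx, l2Tw_symm hy hz, l2Tw_symm hx hz,
    wedge_comm_sg (l2Tw_mem hz hx k) hy]
  simp only [map_smul, smul_add, smul_smul, ← sg_add]
  rw [add_comm]
  congr 2 <;> apply sg_congr <;>
    simp only [Int.even_add, Int.even_mul, Int.not_even_one] <;> tauto

lemma l2Tw_jacobi (hx : x ∈ 𝒜 (-i)) (hy : y ∈ 𝒜 (-j)) (hz : z ∈ 𝒜 (-k)) :
    l2Tw G (i + j + 1) (l2Tw G i x y) z + sg (j * k) • l2Tw G (i + k + 1) (l2Tw G i x z) y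
      + sg (i * (j + k)) • l2Tw G (j + k + 1) (l2Tw G j y z) x = 0 := by
  have h1 := l2Tw_symm (G := G) (l2Tw_mem (G := G) hx hz i) hy
  have h2 := l2Tw_symm (G := G) (l2Tw_mem (G := G) hy hz j) hx
  have h3 := G.jacobi _ _ x y z hx hy
  rw [zsmul_eq_sg_smul] at h3
  rw [h1, h2]
  simp only [l2Tw_apply, map_smul, smul_smul, LinearMap.smul_apply]
  rw [h3]
  simp only [sg_eq_ite, Int.even_add, Int.even_sub, Int.even_mul, even_neg, Int.not_even_one]
  by_cases hi : Even i <;> by_cases hj : Even j <;> by_cases hk : Even k <;>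
    simp only [hi, hj, hk, iff_true, iff_false, or_true, or_false, not_true, if_true,
      if_false] <;> module

end UnitalGerstenhaber

section ListForms

variable {V : Type*} [AddCommGroup V] [Module ℝ V] {𝒜 : ℤ → Submodule ℝ V}
variable {H : Type*} (G : Gerstenhaber 𝒜) (e : V) (deg : H → ℤ) (val : H → V)

/-- The wedge product of a list of elements, with the unit `e` as the empty product. -/
def wedgeList : List H → V
  | [] => e
  | x :: xs => G.wedge (val x) (wedgeList xs)

/-- The identity form, supported on lists of length one. -/
def idList : List H → V
  | [x] => val x
  | _ => 0

/-- The form `l_2`, supported on lists of length two. -/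
noncomputable def brList : List H → V
  | [x, y] => l2Tw G (deg x) (val x) (val y)
  | _ => 0

/-- The form `ι_{l_2} 𝒩`, that is, all the `l_k` together. -/
noncomputable def lList (xs : List H) : V :=
  splitSum deg xs fun A B => G.wedge (brList G deg val A) (wedgeList G e val B)

variable {G e deg val}

omit [Module ℝ V] in
lemma idList_eq_zero {A : List H} (h : A.length ≠ 1) : idList val A = 0 := by
  match A with
  | [] => rfl
  | [_] => simp at h
  | _ :: _ :: _ => rfl

lemma brList_eq_zero {A : List H} (h : A.length ≠ 2) : brList G deg val A = 0 := by
  match A with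
  | [] => rfl
  | [_] => rfl
  | [_, _] => simp at h
  | _ :: _ :: _ :: _ => rfl

lemma brList_cons (x : H) (A : List H) :
    brList G deg val (x :: A) = l2Tw G (deg x) (val x) (idList val A) := by
  match A with
  | [] => simp [brList, idList]
  | [_] => rfl
  | _ :: _ :: _ => simp [brList, idList]

section Membership

variable (hv : ∀ x, val x ∈ 𝒜 (-deg x))
include hv

lemma idList_mem (A : List H) : idList val A ∈ 𝒜 (-listDeg deg A) := by
  match A with
  | [] => exact Submodule.zero_mem _
  | [x] => simpa [idList] using hv x
  | _ :: _ :: _ => exact Submodule.zero_mem _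

lemma wedgeList_mem (he : G.HasUnit e) (A : List H) :
    wedgeList G e val A ∈ 𝒜 (-listDeg deg A) := by
  induction A with
  | nil => simpa [wedgeList] using he.mem
  | cons x A ih => rw [listDeg_cons]; exact wedge_mem_neg (hv x) ih

lemma brList_mem (A : List H) : brList G deg val A ∈ 𝒜 (-(listDeg deg A + 1)) := by
  match A with
  | [] => exact Submodule.zero_mem _
  | [_] => exact Submodule.zero_mem _
  | [x, y] => simpa [brList] using l2Tw_mem (hv x) (hv y) _
  | _ :: _ :: _ :: _ => exact Submodule.zero_mem _

end Membership

lemma splitSum_wedge_right (xs : List H) (F : List H → List H → V) (y : V) :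
    splitSum deg xs (fun A B => G.wedge (F A B) y) = G.wedge (splitSum deg xs F) y :=
  splitSum_map (G.wedge.flip y) xs F

/-- The coefficient in the product of a weighted wedge product with the wedge product. -/
def binomWeight (ω : ℕ → ℝ) : ℕ → ℝ
  | 0 => ω 0
  | n + 1 => binomWeight (fun k => ω (k + 1)) n + binomWeight ω n

variable (hv : ∀ x, val x ∈ 𝒜 (-deg x)) (he : G.HasUnit e)
include hv he

local notation "𝐍" => wedgeList G e val
local notation "𝐐" => lList G e deg val
local notation "𝐪" => brList G deg val
local notation "𝐱" => idList val
local notation "𝐒" => splitSum deg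
local notation "δ" => listDeg deg

lemma splitSum_wedgeList_wedgeList (ω : ℕ → ℝ) (xs : List H) :
    𝐒 xs (fun A B => ω A.length • G.wedge (𝐍 A) (𝐍 B)) = binomWeight ω xs.length • 𝐍 xs := by
  induction xs generalizing ω with
  | nil => simp [splitSum, wedgeList, he.unit_wedge, binomWeight]
  | cons x xs ih =>
    have h1 : 𝐒 xs (fun A B => ω (x :: A).length • G.wedge (𝐍 (x :: A)) (𝐍 B))
        = binomWeight (fun k => ω (k + 1)) xs.length • 𝐍 (x :: xs) := by
      simp only [wedgeList, ← map_smul, ← ih, ← splitSum_map, G.wedge_assoc]; simp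
    have h2 : 𝐒 xs (fun A B => sg (deg x * δ A) • ω A.length • G.wedge (𝐍 A) (𝐍 (x :: B)))
        = binomWeight ω xs.length • 𝐍 (x :: xs) := by
      simp only [wedgeList, ← map_smul, ← ih, ← splitSum_map]
      congr 1; ext A B
      rw [← G.wedge_assoc, wedge_comm_sg (wedgeList_mem hv he A) (hv x), ← G.wedge_assoc]
      simp only [map_smul, LinearMap.smul_apply, G.wedge_assoc, smul_smul]
      congr 1
      rw [mul_comm (δ A), mul_right_comm, sg_mul_self, one_mul]
    rw [splitSum, h1, h2, List.length_cons, binomWeight, add_smul]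

lemma l2Tw_wedgeList {i : ℤ} {y : V} (hy : y ∈ 𝒜 (-i)) (k : ℤ) (xs : List H) :
    l2Tw G k y (𝐍 xs) = 𝐒 xs (fun A B => G.wedge (l2Tw G k y (𝐱 A)) (𝐍 B)) := by
  induction xs with
  | nil => simp [splitSum, wedgeList, idList, l2Tw_apply, he.bracket_unit]
  | cons x xs ih =>
    rw [splitSum, splitSum_left_nil, wedgeList, l2Tw_wedge hy (hv x), ih, ← map_smul,
      ← splitSum_smul, ← splitSum_map]
    · congr 2; ext A B
      simp only [wedgeList]
      rw [map_smul, ← G.wedge_assoc, ← G.wedge_assoc,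
        wedge_comm_sg (l2Tw_mem hy (idList_mem hv A) k) (hv x)]
      simp only [map_smul, LinearMap.smul_apply, smul_smul, ← sg_add]
      congr 1; apply sg_congr
      simp only [Int.even_add, Int.even_mul, Int.not_even_one]; tauto
    · intro A B hA
      rw [idList_eq_zero]
      · simp
      · simpa using hA

lemma wedgeList_l2Tw {k : ℤ} {z : V} (hz : z ∈ 𝒜 (-k)) (xs : List H) :
    l2Tw G (δ xs) (𝐍 xs) z
      = 𝐒 xs (fun A B => sg (δ A) • G.wedge (𝐍 A) (l2Tw G (δ B) (𝐱 B) z)) := by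
  induction xs with
  | nil => simp [splitSum, wedgeList, idList, l2Tw_apply, he.unit_bracket]
  | cons x xs ih =>
    have h1 : 𝐒 xs (fun A B => sg (δ (x :: A)) •
        G.wedge (𝐍 (x :: A)) (l2Tw G (δ B) (𝐱 B) z))
        = sg (deg x) • G.wedge (val x) (l2Tw G (δ xs) (𝐍 xs) z) := by
      simp only [ih, ← splitSum_map, ← splitSum_smul, wedgeList, listDeg_cons, sg_add,
        G.wedge_assoc, map_smul, smul_smul]
    rw [splitSum, h1, splitSum_right_nil, wedgeList, listDeg_cons,
      l2Tw_wedge_left (hv x) (wedgeList_mem hv he xs) hz]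
    · simp only [smul_smul, ← sg_add, idList, listDeg_cons, listDeg_nil, add_zero]
      congr 2; apply sg_congr
      simp only [Int.even_add, Int.even_mul, Int.not_even_one]; tauto
    · intro A B hB
      rw [idList_eq_zero]
      · simp
      · simpa using hB

lemma lList_cons (x : H) (xs : List H) :
    𝐐 (x :: xs) = l2Tw G (deg x) (val x) (𝐍 xs) + sg (deg x) • G.wedge (val x) (𝐐 xs) := by
  rw [lList, splitSum, l2Tw_wedgeList hv he (hv x)]
  simp only [brList_cons]
  rw [lList, ← map_smul, ← splitSum_smul, ← splitSum_map]
  congr 2; ext A B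
  rw [wedgeList, ← G.wedge_assoc, wedge_comm_sg (brList_mem hv A) (hv x)]
  simp only [map_smul, LinearMap.smul_apply, smul_smul, ← sg_add, G.wedge_assoc]
  congr 1; apply sg_congr
  simp only [Int.even_add, Int.even_mul, Int.not_even_one]; tauto

lemma lList_mem (xs : List H) : 𝐐 xs ∈ 𝒜 (-(δ xs + 1)) := by
  induction xs with
  | nil => simp [lList, splitSum, brList]
  | cons x xs ih =>
    rw [lList_cons hv he, listDeg_cons]
    exact Submodule.add_mem _ (l2Tw_mem (hv x) (wedgeList_mem hv he xs) _)
      (Submodule.smul_mem _ _ (mem_of_eq (wedge_mem_neg (hv x) ih) (by ring)))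

lemma splitSum_lList_wedgeList (ω : ℕ → ℝ) (xs : List H) :
    𝐒 xs (fun D C => ω D.length • G.wedge (𝐐 D) (𝐍 C))
      = binomWeight (fun k => ω (k + 2)) (xs.length - 2) • 𝐐 xs := by
  have h1 : 𝐒 xs (fun D C => ω D.length • G.wedge (𝐐 D) (𝐍 C))
      = 𝐒 xs (fun D C => 𝐒 D (fun A B =>
          ω (A.length + B.length) • G.wedge (G.wedge (𝐪 A) (𝐍 B)) (𝐍 C))) := by
    congr 1; ext D C
    rw [lList, ← splitSum_wedge_right, ← splitSum_smul]
    exact splitSum_congr fun A B h => by rw [h]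
  rw [h1, splitSum_assoc, lList, ← splitSum_smul]
  refine splitSum_congr fun A D h => ?_
  by_cases hA : A.length = 2
  · rw [← map_smul, show xs.length - 2 = D.length by omega,
      ← splitSum_wedgeList_wedgeList hv he, ← splitSum_map]
    simp only [hA, map_smul, G.wedge_assoc, add_comm 2]
  · simp [brList_eq_zero hA, splitSum_zero]

lemma splitSum_wedgeList_lList (ω : ℕ → ℝ) (xs : List H) :
    𝐒 xs (fun A B => ω A.length • sg (δ A) • G.wedge (𝐍 A) (𝐐 B))
      = binomWeight (fun k => ω (xs.length - (k + 2))) (xs.length - 2) • 𝐐 xs := by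
  rw [splitSum_comm, ← splitSum_lList_wedgeList hv he (fun k => ω (xs.length - k))]
  refine splitSum_congr fun A B h => ?_
  rw [show xs.length - A.length = B.length by omega,
    wedge_comm_sg (wedgeList_mem hv he B) (lList_mem hv he A), smul_comm (ω _)]
  have hs : sg (δ A * δ B) * sg (δ B) * sg (δ B * (δ A + 1)) = 1 := by
    simp only [← sg_add]
    apply sg_of_even
    simp only [Int.even_add, Int.even_mul, Int.not_even_one]; tauto
  simp only [smul_smul]
  congr 1
  linear_combination ω B.length * hs

omit he in
lemma splitSum_idList_idList (xs : List H) :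
    𝐒 xs (fun A B => l2Tw G (δ A) (𝐱 A) (𝐱 B)) = (2 : ℝ) • 𝐪 xs := by
  match xs with
  | [] => simp [splitSum, idList, brList]
  | [x] => simp [splitSum, idList, brList]
  | [x, y] =>
    simp [splitSum, idList, brList]
    rw [l2Tw_symm (hv y) (hv x), smul_smul, mul_comm (deg y), sg_mul_self, one_smul, two_smul]
  | a :: b :: c :: l =>
    rw [brList_eq_zero (by simp), smul_zero]
    refine splitSum_eq_zero fun A B h => ?_
    by_cases hA : A.length = 1
    · rw [idList_eq_zero (A := B) (by simp at h; omega)]; simp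
    · rw [idList_eq_zero hA]; simp

lemma splitSum_idList_wedgeList (xs : List H) :
    𝐒 xs (fun A B => l2Tw G (δ A) (𝐱 A) (𝐍 B)) = (2 : ℝ) • 𝐐 xs := by
  have h1 : 𝐒 xs (fun A B => l2Tw G (δ A) (𝐱 A) (𝐍 B)) = 𝐒 xs (fun A D => 𝐒 D (fun B C =>
      G.wedge (l2Tw G (δ A) (𝐱 A) (𝐱 B)) (𝐍 C))) := by
    congr 1; ext A D
    exact l2Tw_wedgeList hv he (idList_mem hv A) _ _
  rw [h1, ← splitSum_assoc, lList, ← splitSum_smul]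
  congr 1; ext D C
  rw [splitSum_wedge_right, splitSum_idList_idList hv, map_smul, LinearMap.smul_apply]

lemma splitSum_wedgeList_idList (xs : List H) :
    𝐒 xs (fun A B => l2Tw G (δ A) (𝐍 A) (𝐱 B)) = (2 : ℝ) • 𝐐 xs := by
  rw [← splitSum_idList_wedgeList hv he, splitSum_comm]
  congr 1; ext A B
  rw [l2Tw_symm (wedgeList_mem hv he B) (idList_mem hv A), smul_smul, mul_comm (δ B),
    sg_mul_self, one_smul]

lemma splitSum_l2Tw_wedgeList_wedgeList (ω : ℕ → ℝ) (xs : List H) :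
    𝐒 xs (fun A B => ω A.length • l2Tw G (δ A) (𝐍 A) (𝐍 B))
      = (2 * binomWeight (fun k => ω (xs.length - (k + 2) + 1)) (xs.length - 2)) • 𝐐 xs := by
  rw [mul_smul, ← splitSum_wedgeList_lList hv he (fun k => ω (k + 1)), ← splitSum_smul]
  have h1 : 𝐒 xs (fun D C => ω D.length • l2Tw G (δ D) (𝐍 D) (𝐍 C))
      = 𝐒 xs (fun D C => 𝐒 D (fun A B => ω (A.length + B.length) •
          sg (δ A) • G.wedge (𝐍 A) (l2Tw G (δ B) (𝐱 B) (𝐍 C)))) := by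
    congr 1; ext D C
    rw [wedgeList_l2Tw hv he (wedgeList_mem hv he C), ← splitSum_smul]
    exact splitSum_congr fun A B h => by rw [h]
  rw [h1, splitSum_assoc]
  congr 1; ext A D
  have h2 : 𝐒 D (fun B C => ω (A.length + B.length) •
        sg (δ A) • G.wedge (𝐍 A) (l2Tw G (δ B) (𝐱 B) (𝐍 C)))
      = 𝐒 D (fun B C => ω (A.length + 1) •
        sg (δ A) • G.wedge (𝐍 A) (l2Tw G (δ B) (𝐱 B) (𝐍 C))) :=
    splitSum_congr fun B C _ => by
      by_cases hB : B.length = 1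
      · rw [hB]
      · simp [idList_eq_zero hB]
  rw [h2]
  simp only [splitSum_smul, splitSum_map]
  rw [splitSum_idList_wedgeList hv he, map_smul, smul_comm (sg _), smul_comm (ω _)]

omit he in
lemma splitSum_brList_brList (xs : List H) :
    𝐒 xs (fun A B => sg (δ A) • G.wedge (𝐪 A) (𝐪 B)) = 0 := by
  have h : 𝐒 xs (fun A B => sg (δ A) • G.wedge (𝐪 A) (𝐪 B))
      = (-1 : ℝ) • 𝐒 xs (fun A B => sg (δ A) • G.wedge (𝐪 A) (𝐪 B)) := by
    conv_lhs => rw [splitSum_comm]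
    rw [← splitSum_smul]
    congr 1; ext A B
    rw [wedge_comm_sg (brList_mem hv B) (brList_mem hv A), show (-1 : ℝ) = sg 1 by simp [sg]]
    simp only [smul_smul, ← sg_add]
    congr 1; apply sg_congr
    simp only [Int.even_add, Int.even_mul, Int.not_even_one]; tauto
  have h2 : (2 : ℝ) • 𝐒 xs (fun A B => sg (δ A) • G.wedge (𝐪 A) (𝐪 B)) = 0 := by
    rw [two_smul]; nth_rewrite 1 [h]; simp
  simpa using h2

omit he in
lemma splitSum_brList_lList (xs : List H) :
    𝐒 xs (fun A B => sg (δ A) • G.wedge (𝐪 A) (𝐐 B)) = 0 := by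
  have h1 : 𝐒 xs (fun A B => sg (δ A) • G.wedge (𝐪 A) (𝐐 B)) = 𝐒 xs (fun A D => 𝐒 D
      (fun B C => G.wedge (sg (δ A) • G.wedge (𝐪 A) (𝐪 B)) (𝐍 C))) := by
    congr 1; ext A D
    rw [lList, ← splitSum_map, ← splitSum_smul]
    simp [G.wedge_assoc]
  rw [h1, ← splitSum_assoc]
  refine splitSum_eq_zero fun D C _ => ?_
  rw [splitSum_wedge_right, splitSum_brList_brList hv, map_zero, LinearMap.zero_apply]

lemma splitSum_lList_lList (ω : ℕ → ℝ) (xs : List H) :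
    𝐒 xs (fun A B => ω A.length • sg (δ A) • G.wedge (𝐐 A) (𝐐 B)) = 0 := by
  have h1 : 𝐒 xs (fun D C => ω D.length • sg (δ D) • G.wedge (𝐐 D) (𝐐 C))
      = 𝐒 xs (fun D C => 𝐒 D (fun A B => ω (A.length + B.length) • sg (δ A + δ B) •
          G.wedge (G.wedge (𝐪 A) (𝐍 B)) (𝐐 C))) := by
    congr 1; ext D C
    rw [lList.eq_1 (xs := D), ← splitSum_wedge_right, ← splitSum_smul, ← splitSum_smul]
    refine Eq.trans (b := 𝐒 D (fun A B => ω (A.length + B.length) • sg (δ D) •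
          G.wedge (G.wedge (𝐪 A) (𝐍 B)) (𝐐 C))) ?_ ?_
    · exact splitSum_congr fun A B h => by rw [h]
    · exact splitSum_congr_deg fun A B h => by rw [h]
  rw [h1, splitSum_assoc]
  have h2 : ∀ A D, A.length + D.length = xs.length →
      𝐒 D (fun B C => ω (A.length + B.length) • sg (δ A + δ B) •
          G.wedge (G.wedge (𝐪 A) (𝐍 B)) (𝐐 C))
      = binomWeight (fun k => ω (2 + (xs.length - 2 - (k + 2)))) (xs.length - 2 - 2) •
          sg (δ A) • G.wedge (𝐪 A) (𝐐 D) := by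
    intro A D h
    by_cases hA : A.length = 2
    · rw [smul_comm, ← map_smul, show xs.length - 2 = D.length by omega,
        ← splitSum_wedgeList_lList hv he (fun k => ω (2 + k)), ← splitSum_map, ← splitSum_smul]
      congr 1; ext B C
      simp only [hA, map_smul, G.wedge_assoc, sg_add, smul_smul]
      congr 1; ring
    · simp [brList_eq_zero hA, splitSum_zero]
  rw [splitSum_congr h2, splitSum_smul, splitSum_brList_lList hv, smul_zero]

omit he in
lemma splitSum_brList_idList (xs : List H) :
    𝐒 xs (fun A B => l2Tw G (δ A + 1) (𝐪 A) (𝐱 B)) = 0 := by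
  match xs with
  | [] => simp [splitSum, idList, brList]
  | [x] => simp [splitSum, idList, brList]
  | [x, y] => simp [splitSum, idList, brList]
  | [x, y, z] =>
    have h := l2Tw_jacobi (G := G) (hv x) (hv y) (hv z)
    simpa [splitSum, idList, brList] using h
  | a :: b :: c :: d :: l =>
    refine splitSum_eq_zero fun A B h => ?_
    by_cases hA : A.length = 2
    · rw [idList_eq_zero (A := B) (by simp at h; omega)]; simp
    · rw [brList_eq_zero hA]; simp

lemma splitSum_lList_idList (xs : List H) :
    𝐒 xs (fun A B => l2Tw G (δ A + 1) (𝐐 A) (𝐱 B)) = 0 := by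
  have h1 : 𝐒 xs (fun A B => l2Tw G (δ A + 1) (𝐐 A) (𝐱 B))
      = 𝐒 xs (fun D C => 𝐒 D (fun A B =>
          sg (δ A + 1) • G.wedge (𝐪 A) (l2Tw G (δ B) (𝐍 B) (𝐱 C))))
      + 𝐒 xs (fun D C => 𝐒 D (fun A B =>
          G.wedge (𝐍 A) (l2Tw G (δ B + 1) (𝐪 B) (𝐱 C)))) := by
    rw [← splitSum_add]
    congr 1; ext D C
    conv_rhs => enter [2]; rw [splitSum_comm]
    rw [← splitSum_add, lList, ← (l2Tw G (δ D + 1)).flip_apply, ← splitSum_map]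
    refine splitSum_congr_deg fun A B h => ?_
    rw [LinearMap.flip_apply, ← h, show δ A + δ B + 1 = (δ A + 1) + δ B by ring,
      l2Tw_wedge_left (brList_mem hv A) (wedgeList_mem hv he B) (idList_mem hv C)]
    congr 2; apply sg_congr
    simp only [Int.even_add, Int.even_mul, Int.not_even_one]; tauto
  rw [h1, splitSum_assoc, splitSum_assoc]
  simp only [splitSum_map, splitSum_smul, splitSum_wedgeList_idList hv he,
    splitSum_brList_idList hv, map_zero, splitSum_zero, add_zero]
  have h2 := splitSum_brList_lList (G := G) (e := e) hv xs
  calc _ = 𝐒 xs (fun A B => (-2 : ℝ) • sg (δ A) • G.wedge (𝐪 A) (𝐐 B)) := by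
        congr 1; ext A B
        rw [map_smul, sg_add, show sg 1 = -1 by simp [sg]]
        module
    _ = 0 := by rw [splitSum_smul, h2, smul_zero]

lemma splitSum_l2Tw_lList_wedgeList (ω : ℕ → ℝ) (xs : List H) :
    𝐒 xs (fun A B => ω A.length • l2Tw G (δ A + 1) (𝐐 A) (𝐍 B)) = 0 := by
  have h1 : 𝐒 xs (fun A D => ω A.length • l2Tw G (δ A + 1) (𝐐 A) (𝐍 D)) = 𝐒 xs (fun A D => 𝐒 D
      (fun B C => G.wedge (ω A.length • l2Tw G (δ A + 1) (𝐐 A) (𝐱 B)) (𝐍 C))) := by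
    congr 1; ext A D
    rw [l2Tw_wedgeList hv he (lList_mem hv he A), ← splitSum_smul]
    simp only [map_smul, LinearMap.smul_apply]
  rw [h1, ← splitSum_assoc]
  refine splitSum_eq_zero fun D C _ => ?_
  rw [splitSum_wedge_right]
  have h2 : 𝐒 D (fun A B => ω A.length • l2Tw G (δ A + 1) (𝐐 A) (𝐱 B))
      = 𝐒 D (fun A B => ω (D.length - 1) • l2Tw G (δ A + 1) (𝐐 A) (𝐱 B)) :=
    splitSum_congr fun A B h => by
      by_cases hB : B.length = 1
      · rw [show D.length - 1 = A.length by omega]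
      · simp [idList_eq_zero hB]
  rw [h2, splitSum_smul, splitSum_lList_idList hv he, smul_zero, map_zero,
    LinearMap.zero_apply]

end ListForms

section UnitExtension

variable {V : Type*} [AddCommGroup V] [Module ℝ V]

/-- The grading on `ℝ × V` obtained from a grading on `V` by adjoining a unit in degree `0`. -/
def unitGrading (𝒜 : ℤ → Submodule ℝ V) (i : ℤ) : Submodule ℝ (ℝ × V) where
  carrier := {x | (i ≠ 0 → x.1 = 0) ∧ x.2 ∈ 𝒜 i}
  add_mem' hx hy := ⟨fun h => by simp [hx.1 h, hy.1 h], add_mem hx.2 hy.2⟩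
  zero_mem' := ⟨fun _ => rfl, zero_mem _⟩
  smul_mem' c _ hx := ⟨fun h => by simp [hx.1 h], Submodule.smul_mem _ c hx.2⟩

variable {𝒜 : ℤ → Submodule ℝ V}

lemma sign_smul_of_mem_unitGrading {i : ℤ} {x : ℝ × V} (hx : x ∈ unitGrading 𝒜 i) (j : ℤ) (v : V) :
    ((-1 : ℤ) ^ (i * j).natAbs) • x.1 • v = x.1 • v := by
  by_cases h : i = 0
  · simp [h]
  · simp [hx.1 h]

/-- The Gerstenhaber algebra obtained by adjoining a unit. -/
noncomputable def Gerstenhaber.unitExt (G : Gerstenhaber 𝒜) : Gerstenhaber (unitGrading 𝒜) where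
  wedge := LinearMap.mk₂ ℝ (fun x y => (x.1 * y.1, x.1 • y.2 + y.1 • x.2 + G.wedge x.2 y.2))
    (fun x x' y => by
      ext
      · simp [add_mul]
      · simp only [Prod.fst_add, Prod.snd_add, map_add, LinearMap.add_apply]; module)
    (fun c x y => by
      ext
      · simp [mul_assoc]
      · simp only [Prod.smul_fst, Prod.smul_snd, map_smul, LinearMap.smul_apply,
          smul_eq_mul]; module)
    (fun x y y' => by
      ext
      · simp [mul_add]
      · simp only [Prod.fst_add, Prod.snd_add, map_add]; module)
    (fun c x y => by
      ext
      · simp only [Prod.smul_fst, smul_eq_mul]; ring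
      · simp only [Prod.smul_fst, Prod.smul_snd, map_smul, smul_eq_mul]; module)
  bracket := LinearMap.mk₂ ℝ (fun x y => (0, G.bracket x.2 y.2))
    (fun x x' y => by ext <;> simp) (fun c x y => by ext <;> simp)
    (fun x y y' => by ext <;> simp) (fun c x y => by ext <;> simp)
  wedge_mem i j x y hx hy := by
    refine ⟨fun h => ?_, add_mem (add_mem ?_ ?_) (G.wedge_mem _ _ _ _ hx.2 hy.2)⟩
    · by_cases hi : i = 0
      · simp [hy.1 (by omega)]
      · simp [hx.1 hi]
    · by_cases hi : i = 0
      · simpa [hi] using Submodule.smul_mem _ _ hy.2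
      · simp [hx.1 hi]
    · by_cases hj : j = 0
      · simpa [hj] using Submodule.smul_mem _ _ hx.2
      · simp [hy.1 hj]
  bracket_mem i j x y hx hy := ⟨fun _ => rfl, G.bracket_mem _ _ _ _ hx.2 hy.2⟩
  wedge_assoc x y z := by
    ext
    · simp [mul_assoc]
    · simp only [LinearMap.mk₂_apply, map_add, map_smul, LinearMap.add_apply,
        LinearMap.smul_apply, G.wedge_assoc]
      module
  wedge_comm i j x y hx hy := by
    ext
    · by_cases h : i = 0
      · simp [h, mul_comm]
      · simp [hx.1 h]
    · simp only [LinearMap.mk₂_apply, Prod.smul_snd, smul_add,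
        sign_smul_of_mem_unitGrading hx, G.wedge_comm _ _ _ _ hx.2 hy.2]
      rw [mul_comm i j, sign_smul_of_mem_unitGrading hy, add_comm (x.1 • y.2)]
  bracket_antisymm i j x y hx hy := by
    ext
    · simp
    · simpa using G.bracket_antisymm _ _ _ _ hx.2 hy.2
  jacobi i j x y z hx hy := by
    ext
    · simp
    · simpa using G.jacobi _ _ _ _ z.2 hx.2 hy.2
  leibniz i j x y z hx hy := by
    ext
    · simp
    · simp only [LinearMap.mk₂_apply, map_add, map_smul, Prod.snd_add, Prod.smul_snd, smul_add,
        G.leibniz _ _ _ _ z.2 hx.2 hy.2, zero_smul, smul_zero]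
      rw [mul_comm (i - 1) j, sign_smul_of_mem_unitGrading hy]
      module

lemma Gerstenhaber.unitExt_wedge (G : Gerstenhaber 𝒜) (x y : ℝ × V) :
    G.unitExt.wedge x y = (x.1 * y.1, x.1 • y.2 + y.1 • x.2 + G.wedge x.2 y.2) := rfl

lemma Gerstenhaber.unitExt_bracket (G : Gerstenhaber 𝒜) (x y : ℝ × V) :
    G.unitExt.bracket x y = (0, G.bracket x.2 y.2) := rfl

lemma Gerstenhaber.unitExt_hasUnit (G : Gerstenhaber 𝒜) : G.unitExt.HasUnit (1, 0) where
  mem := ⟨fun h => absurd rfl h, zero_mem _⟩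
  unit_wedge x := by simp [unitExt_wedge]
  wedge_unit x := by simp [unitExt_wedge]
  bracket_unit x := by simp [unitExt_bracket]
  unit_bracket x := by simp [unitExt_bracket]

end UnitExtension

section Unshuffles

variable {H M : Type*} [AddCommGroup M] [Module ℝ M] (deg : H → ℤ)

/-- The Koszul sign of moving the elements indexed by `A` in front of those indexed by `B`. -/
noncomputable def blockSign {ι : Type*} [LinearOrder ι] (h : ι → H) (A B : Finset ι) : ℝ :=
  ∏ a ∈ A, ∏ b ∈ B, if b < a then sg (deg (h a) * deg (h b)) else 1

lemma sg_mul_listDeg_sort {ι : Type*} [LinearOrder ι] (h : ι → H) (A : Finset ι) (m : ℤ) :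
    sg (m * listDeg deg (A.sort.map h)) = ∏ a ∈ A, sg (deg (h a) * m) := by
  have h1 : listDeg deg (A.sort.map h) = ∑ a ∈ A, deg (h a) := by
    rw [listDeg, List.map_map, ← List.sum_toFinset _ (Finset.sort_nodup _ _),
      Finset.sort_toFinset]
    rfl
  rw [h1]
  clear h1
  induction A using Finset.induction_on with
  | empty => simp
  | insert a s ha ih =>
    rw [Finset.sum_insert ha, Finset.prod_insert ha, mul_add, sg_add, ih, mul_comm m]

lemma splitSum_map_eq_sum_powerset {ι : Type*} [LinearOrder ι] (h : ι → H) (l : List ι)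
    (hl : l.Pairwise (· < ·)) (F : List H → List H → M) :
    splitSum deg (l.map h) F = ∑ A ∈ l.toFinset.powerset,
      blockSign deg h A (l.toFinset \ A) •
        F (A.sort.map h) ((l.toFinset \ A).sort.map h) := by
  induction l generalizing F with
  | nil => simp [splitSum, blockSign]
  | cons a l ih =>
    rw [List.pairwise_cons] at hl
    have ha : a ∉ l.toFinset := fun h => lt_irrefl _ (hl.1 a (List.mem_toFinset.mp h))
    have hsort : ∀ A ⊆ l.toFinset, (insert a A).sort = a :: A.sort := fun A hA =>
      Finset.sort_insert (r := (· ≤ ·))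
        (fun b hb => (hl.1 b (List.mem_toFinset.mp (Finset.mem_of_subset hA hb))).le)
        (fun h => ha (Finset.mem_of_subset hA h))
    rw [List.map_cons, splitSum, ih hl.2, ih hl.2, List.toFinset_cons,
      Finset.sum_powerset_insert ha, add_comm]
    congr 1
    · refine Finset.sum_congr rfl fun A hA => ?_
      rw [Finset.mem_powerset] at hA
      have haA : a ∉ A := fun h => ha (hA h)
      rw [Finset.insert_sdiff_of_notMem _ haA, hsort _ Finset.sdiff_subset, smul_smul,
        List.map_cons, sg_mul_listDeg_sort]
      congr 1
      rw [blockSign, blockSign, ← Finset.prod_mul_distrib]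
      refine Finset.prod_congr rfl fun b hb => ?_
      rw [Finset.prod_insert (by simp [ha]), if_pos (hl.1 b (List.mem_toFinset.mp (hA hb))),
        mul_comm]
    · refine Finset.sum_congr rfl fun A hA => ?_
      rw [Finset.mem_powerset] at hA
      have haA : a ∉ A := fun h => ha (hA h)
      rw [Finset.insert_sdiff_insert, Finset.sdiff_insert_of_notMem ha, hsort _ hA, List.map_cons]
      congr 1
      rw [blockSign, blockSign, Finset.prod_insert haA]
      conv_lhs => rw [← one_mul (∏ _ ∈ A, _)]
      congr 1
      refine (Finset.prod_eq_one fun b hb => if_neg ?_).symm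
      exact (hl.1 b (List.mem_toFinset.mp (Finset.sdiff_subset hb))).le.not_gt

lemma mem_unshuffles {k l : ℕ} {σ : Equiv.Perm (Fin (k + l))} :
    σ ∈ unshuffles k (k + l) ↔ StrictMono (fun i : Fin k => σ (Fin.castAdd l i))
      ∧ StrictMono (fun j : Fin l => σ (Fin.natAdd k j)) := by
  simp only [unshuffles, Finset.mem_filter, Finset.mem_univ, true_and]
  constructor
  · rintro ⟨h1, h2⟩
    exact ⟨fun i j hij => h1 _ _ (Fin.strictMono_castAdd l hij) (by simp),
      fun i j hij => h2 _ _ (Fin.strictMono_natAdd k hij) (by simp)⟩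
  · rintro ⟨h1, h2⟩
    refine ⟨fun i j hij hj => ?_, fun i j hij hi => ?_⟩
    · exact h1 (a := ⟨i, by omega⟩) (b := ⟨j, hj⟩) hij
    · have := h2 (a := ⟨i - k, by omega⟩) (b := ⟨j - k, by omega⟩)
        (by simp only [Fin.mk_lt_mk]; omega)
      have hk : ∀ (m : Fin (k + l)) (hm : k ≤ m), Fin.natAdd k ⟨m - k, by omega⟩ = m :=
        fun m hm => Fin.ext (by simp; omega)
      simpa only [hk i hi, hk j (hi.trans hij.le)] using this

lemma sort_image_of_strictMono {ι : Type*} [LinearOrder ι] {k : ℕ} {f : Fin k → ι}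
    (hf : StrictMono f) : (Finset.univ.image f).sort = List.ofFn f := by
  have h1 : Finset.univ.image f = (List.ofFn f).toFinset := by ext; simp [List.mem_ofFn]
  rw [h1]
  exact (List.toFinset_sort (· ≤ ·) (List.nodup_ofFn.mpr hf.injective)).mpr
    (List.pairwise_ofFn.mpr fun _ _ h => (hf h).le)

lemma koszulSign_unshuffle {k l : ℕ} (h : Fin (k + l) → H) {σ : Equiv.Perm (Fin (k + l))}
    (hσ : σ ∈ unshuffles k (k + l)) :
    (koszulSign (fun i => deg (h i)) σ : ℝ)
      = blockSign deg h (Finset.univ.image fun i : Fin k => σ (Fin.castAdd l i))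
          (Finset.univ.image fun j : Fin l => σ (Fin.natAdd k j)) := by
  obtain ⟨h1, h2⟩ := mem_unshuffles.mp hσ
  have hc : ∀ (i : Fin k) (j : Fin l), Fin.castAdd l i < Fin.natAdd k j := fun i j => by
    simp only [Fin.lt_def, Fin.val_castAdd, Fin.val_natAdd]; omega
  rw [blockSign, Finset.prod_image h1.injective.injOn]
  simp only [Finset.prod_image h2.injective.injOn]
  rw [koszulSign, Finset.prod_filter, Fintype.prod_prod_type, Fin.prod_univ_add]
  simp only [Fin.prod_univ_add, Int.cast_mul, Int.cast_prod]
  have e1 : ∀ i i' : Fin k, ¬ (Fin.castAdd l i < Fin.castAdd l i' ∧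
      σ (Fin.castAdd l i') < σ (Fin.castAdd l i)) := fun i i' ⟨hi, hi'⟩ =>
    (h1 ((Fin.strictMono_castAdd l).lt_iff_lt.mp hi)).not_gt hi'
  have e2 : ∀ i i' : Fin l, ¬ (Fin.natAdd k i < Fin.natAdd k i' ∧
      σ (Fin.natAdd k i') < σ (Fin.natAdd k i)) := fun i i' ⟨hi, hi'⟩ =>
    (h2 ((Fin.strictMono_natAdd k).lt_iff_lt.mp hi)).not_gt hi'
  simp only [e1, e2, hc, (hc _ _).not_gt, if_false, true_and, false_and, Int.cast_one,
    Finset.prod_const_one, one_mul, mul_one]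
  refine Finset.prod_congr rfl fun i _ => Finset.prod_congr rfl fun j _ => ?_
  split_ifs <;> simp [sg]

lemma sum_unshuffles {k l : ℕ} (h : Fin (k + l) → H) (F : List H → List H → M) :
    ∑ σ ∈ unshuffles k (k + l), koszulSign (fun i => deg (h i)) σ •
        F (List.ofFn fun i : Fin k => h (σ (Fin.castAdd l i)))
          (List.ofFn fun j : Fin l => h (σ (Fin.natAdd k j)))
      = splitSum deg (List.ofFn h) (fun A B => if A.length = k then F A B else 0) := by
  have himg : ∀ σ : Equiv.Perm (Fin (k + l)),
      (Finset.univ.image fun i : Fin k => σ (Fin.castAdd l i))ᶜ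
        = Finset.univ.image fun j : Fin l => σ (Fin.natAdd k j) := by
    intro σ
    ext x
    obtain ⟨y, rfl⟩ := σ.surjective x
    simp only [Finset.mem_compl, Finset.mem_image, Finset.mem_univ, true_and,
      EmbeddingLike.apply_eq_iff_eq]
    refine Fin.addCases (fun i => ?_) (fun j => ?_) y
    · simp [Fin.ext_iff]; intro j; omega
    · simp [Fin.ext_iff]; intro j; omega
  have hofn : List.ofFn h = (List.finRange (k + l)).map h := by
    simp [List.ofFn_eq_map]
  rw [hofn, splitSum_map_eq_sum_powerset deg h _ (List.sortedLT_finRange _).pairwise]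
  simp only [List.toFinset_finRange, Finset.powerset_univ, List.length_map, Finset.length_sort,
    smul_ite, smul_zero, ← Finset.compl_eq_univ_sdiff]
  rw [← Finset.sum_filter]
  refine Finset.sum_bij (fun σ _ => Finset.univ.image fun i : Fin k => σ (Fin.castAdd l i))
    (fun σ hσ => ?_) (fun σ hσ τ hτ hst => ?_) (fun A hA => ?_) (fun σ hσ => ?_)
  · simp only [Finset.mem_filter, Finset.mem_univ, true_and]
    rw [Finset.card_image_of_injective _ (mem_unshuffles.mp hσ).1.injective]
    simp
  · have hst' := congrArg compl hst
    simp only [himg] at hst'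
    obtain ⟨hσ1, hσ2⟩ := mem_unshuffles.mp hσ
    obtain ⟨hτ1, hτ2⟩ := mem_unshuffles.mp hτ
    have h1 := congrArg (fun s => Finset.sort s) hst
    have h2 := congrArg (fun s => Finset.sort s) hst'
    simp only [sort_image_of_strictMono hσ1, sort_image_of_strictMono hτ1] at h1
    simp only [sort_image_of_strictMono hσ2, sort_image_of_strictMono hτ2] at h2
    exact Equiv.ext fun x => Fin.addCases (congrFun (List.ofFn_injective h1))
      (congrFun (List.ofFn_injective h2)) x
  · simp only [Finset.mem_filter, Finset.mem_univ, true_and] at hA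
    have hAc : Aᶜ.card = l := by rw [Finset.card_compl, hA]; simp
    refine ⟨finSumFinEquiv.symm.trans (finSumEquivOfFinset hA hAc), mem_unshuffles.mpr
      ⟨fun i j hij => ?_, fun i j hij => ?_⟩, ?_⟩
    · simpa using hij
    · simpa using hij
    · ext x
      simp
  · obtain ⟨h1, h2⟩ := mem_unshuffles.mp hσ
    rw [himg, sort_image_of_strictMono h1, sort_image_of_strictMono h2,
      ← koszulSign_unshuffle deg h hσ, Int.cast_smul_eq_zsmul, List.map_ofFn, List.map_ofFn]
    rfl

end Unshuffles

section Representation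

variable {V : Type*} [AddCommGroup V] [Module ℝ V] {𝒢 : ℤ → Submodule ℝ V}

/-- The list of homogeneous elements, with their degrees, on which a form is evaluated. -/
def homogList {n : ℕ} (d : Fin n → ℤ) (x : (i : Fin n) → 𝒢 (d i)) : List (Σ i, 𝒢 i) :=
  List.ofFn fun i => ⟨d i, x i⟩

@[simp] lemma length_homogList {n : ℕ} (d : Fin n → ℤ) (x : (i : Fin n) → 𝒢 (d i)) :
    (homogList d x).length = n := List.length_ofFn

/-- The value in `ℝ × V` of a homogeneous element of `V`. -/
def homogVal (p : Σ i, 𝒢 i) : ℝ × V := (0, (p.2 : V))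

/-- The form `K` is evaluated through the function `f` on lists of homogeneous elements. -/
def IsRepresentedBy {n : ℕ} (K : GForm 𝒢 n) (f : List (Σ i, 𝒢 i) → ℝ × V) : Prop :=
  ∀ d x, ((0 : ℝ), K d x) = f (homogList d x)

variable [DirectSum.Decomposition 𝒢]

/-- The component of `v` whose degree is the total degree of `A` shifted by `m`. -/
def homogPrj (m : ℤ) (A : List (Σ i, 𝒢 i)) (v : V) : Σ i, 𝒢 i :=
  ⟨listDeg Sigma.fst A + m, prj 𝒢 _ v⟩

lemma castForm_insertionOp {k l n : ℕ} (m : ℤ) {K : GForm 𝒢 k} {L : GForm 𝒢 l}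
    {f g : List (Σ i, 𝒢 i) → ℝ × V} (hK : IsRepresentedBy K f) (hL : IsRepresentedBy L g)
    (h : k + l - 1 = n) (hkl : k + l = n + 1) (d : Fin n → ℤ) (x : (i : Fin n) → 𝒢 (d i)) :
    ((0 : ℝ), castForm h (insertionOp 𝒢 m K L) d x)
      = splitSum Sigma.fst (homogList d x) (fun A B =>
          if A.length = k then g (homogPrj m A (f A).2 :: B) else 0) := by
  subst h
  cases l with
  | zero =>
    rw [splitSum_eq_zero]
    · rfl
    · intro A B hAB
      rw [length_homogList] at hAB
      exact if_neg (by omega)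
  | succ l =>
    change ((0 : ℝ), insertPos 𝒢 m K L d x) = _
    have key := sum_unshuffles (k := k) (l := l) Sigma.fst
      (fun i => (⟨d i, x i⟩ : Σ i, 𝒢 i)) (fun A B => g (homogPrj m A (f A).2 :: B))
    refine Eq.trans ?_ key
    change LinearMap.inr ℝ ℝ V (insertPos 𝒢 m K L d x) = _
    rw [insertPos, map_sum]
    refine Finset.sum_congr rfl fun σ _ => ?_
    rw [map_zsmul]
    congr 1
    refine (hL _ _).trans (congrArg g ?_)
    rw [homogList, List.ofFn_succ]
    refine congrArg₂ _ ?_ rfl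
    have hd : listDeg Sigma.fst (List.ofFn fun i : Fin k =>
        (⟨d (σ (Fin.castAdd l i)), x (σ (Fin.castAdd l i))⟩ : Σ i, 𝒢 i))
          = ∑ i : Fin k, d (σ (Fin.castAdd l i)) := by
      rw [listDeg, List.map_ofFn, List.sum_ofFn]; rfl
    rw [homogPrj, hd]
    have hf := congrArg Prod.snd (hK (fun i => d (σ (Fin.castAdd l i)))
      (fun i => x (σ (Fin.castAdd l i))))
    rw [homogList] at hf
    rw [← hf]
    rfl

lemma sum_castForm_insertionOp {M M' : MultiForm 𝒢} (m : ℤ) {f g : List (Σ i, 𝒢 i) → ℝ × V}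
    (hM : ∀ k, IsRepresentedBy (M k) f) (hM' : ∀ k, IsRepresentedBy (M' k) g) {n : ℕ}
    (h : ∀ p : {p // p ∈ Finset.range (n + 2)}, p.1 + (n + 1 - p.1) - 1 = n)
    (d : Fin n → ℤ) (x : (i : Fin n) → 𝒢 (d i)) :
    ((0 : ℝ), (∑ p ∈ (Finset.range (n + 2)).attach,
        castForm (h p) (insertionOp 𝒢 m (M p.1) (M' (n + 1 - p.1)))) d x)
      = splitSum Sigma.fst (homogList d x) (fun A B => g (homogPrj m A (f A).2 :: B)) := by
  have splitSum_sum : ∀ (s : Finset ℕ) (xs : List (Σ i, 𝒢 i))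
      (F : ℕ → List (Σ i, 𝒢 i) → List (Σ i, 𝒢 i) → ℝ × V),
      ∑ i ∈ s, splitSum Sigma.fst xs (F i) = splitSum Sigma.fst xs (fun A B => ∑ i ∈ s, F i A B) := by
    intro s xs F
    induction s using Finset.induction_on with
    | empty => simp [splitSum_zero]
    | insert a s ha ih => simp only [Finset.sum_insert ha, splitSum_add, ih]
  rw [← LinearMap.inr_apply (R := ℝ), Finset.sum_apply, Finset.sum_apply, map_sum]
  have h1 : ∀ p ∈ (Finset.range (n + 2)).attach, LinearMap.inr ℝ ℝ V
      (castForm (h p) (insertionOp 𝒢 m (M p.1) (M' (n + 1 - p.1))) d x)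
      = splitSum Sigma.fst (homogList d x) (fun A B =>
          if A.length = p.1 then g (homogPrj m A (f A).2 :: B) else 0) := fun p _ =>
    castForm_insertionOp m (hM _) (hM' _) (h p)
      (by have := Finset.mem_range.mp p.2; omega) d x
  rw [Finset.sum_congr rfl h1, Finset.sum_attach (Finset.range (n + 2)) (fun p =>
    splitSum Sigma.fst (homogList d x) (fun A B =>
          if A.length = p then g (homogPrj m A (f A).2 :: B) else 0)), splitSum_sum]
  refine splitSum_congr fun A B hAB => ?_
  rw [length_homogList] at hAB
  rw [Finset.sum_ite_eq, if_pos (Finset.mem_range.mpr (by omega))]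

end Representation

section WeakNijenhuis

variable {V : Type*} [AddCommGroup V] [Module ℝ V] {𝒜 : ℤ → Submodule ℝ V}

local notation "𝐍" G => wedgeList (H := Σ i, negG 𝒜 i) (Gerstenhaber.unitExt G) (1, 0) homogVal
local notation "𝐐" G => lList (H := Σ i, negG 𝒜 i) (Gerstenhaber.unitExt G) (1, 0) Sigma.fst homogVal
local notation "𝐪" G => brList (H := Σ i, negG 𝒜 i) (Gerstenhaber.unitExt G) Sigma.fst homogVal

lemma homogVal_mem (p : Σ i, negG 𝒜 i) : homogVal p ∈ unitGrading 𝒜 (-p.1) :=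
  ⟨fun _ => rfl, p.2.2⟩

lemma homogVal_homogPrj [DirectSum.Decomposition (negG 𝒜)] {m : ℤ} {A : List (Σ i, negG 𝒜 i)}
    {v : ℝ × V} (hv : v ∈ unitGrading 𝒜 (-(listDeg Sigma.fst A + m))) (h0 : v.1 = 0) :
    homogVal (homogPrj m A v.2) = v := by
  ext
  · exact h0.symm
  · exact DirectSum.decompose_of_mem_same (negG 𝒜) hv.2

variable (G : Gerstenhaber 𝒜)

lemma fst_brList (A : List (Σ i, negG 𝒜 i)) : ((𝐪 G) A).1 = 0 := by
  match A with
  | [] => rfl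
  | [_] => rfl
  | [x, y] => simp [brList, l2Tw_apply, Gerstenhaber.unitExt_bracket]
  | _ :: _ :: _ :: _ => rfl

lemma fst_wedgeList {A : List (Σ i, negG 𝒜 i)} (hA : A ≠ []) : ((𝐍 G) A).1 = 0 := by
  cases A with
  | nil => exact absurd rfl hA
  | cons x A => simp [wedgeList, Gerstenhaber.unitExt_wedge, homogVal]

lemma fst_lList (A : List (Σ i, negG 𝒜 i)) : ((𝐐 G) A).1 = 0 := by
  have h := splitSum_map (deg := Sigma.fst) (LinearMap.fst ℝ ℝ V) A
    (fun A B => (Gerstenhaber.unitExt G).wedge ((𝐪 G) A) ((𝐍 G) B))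
  refine h.symm.trans (splitSum_eq_zero fun A B _ => ?_)
  simp [Gerstenhaber.unitExt_wedge, fst_brList]

lemma lList_eq_zero {A : List (Σ i, negG 𝒜 i)} (hA : A.length < 2) : (𝐐 G) A = 0 :=
  splitSum_eq_zero fun B C h => by rw [brList_eq_zero (by omega)]; simp

lemma isRepresentedBy_mathcalN (k : ℕ) :
    IsRepresentedBy (mathcalN G (negG 𝒜) (k + 1)) (𝐍 G) := by
  have h : ∀ (k : ℕ) (y : Fin (k + 1) → Σ i, negG 𝒜 i),
      ((0 : ℝ), wedgeAll G (fun i => ((y i).2 : V))) = (𝐍 G) (List.ofFn y) := by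
    intro k
    induction k with
    | zero =>
      intro y
      simp [wedgeAll, wedgeList, homogVal, Gerstenhaber.unitExt_wedge]
    | succ k ih =>
      intro y
      rw [List.ofFn_succ, wedgeList, ← ih, wedgeAll]
      simp [homogVal, Gerstenhaber.unitExt_wedge]
  exact fun d x => h k fun i => ⟨d i, x i⟩

lemma isRepresentedBy_smul_mathcalN {φ : ℕ → ℝ} (k : ℕ) :
    IsRepresentedBy (φ k • mathcalN G (negG 𝒜) k)
      (fun A => (if A.length = 0 then 0 else φ A.length) • (𝐍 G) A) := by
  intro d x
  cases k with
  | zero => simp [mathcalN]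
  | succ k =>
    beta_reduce
    rw [length_homogList, if_neg (by omega), ← isRepresentedBy_mathcalN]
    simp

lemma isRepresentedBy_l2G : IsRepresentedBy (l2G G (negG 𝒜)) (𝐪 G) := by
  intro d x
  have h : homogList d x = [⟨d 0, x 0⟩, ⟨d 1, x 1⟩] := by simp [homogList, List.ofFn_succ]
  rw [h, brList, l2G, zsmul_eq_sg_smul]
  simp [l2Tw_apply, Gerstenhaber.unitExt_bracket, homogVal]

lemma smul_lList_cons (ψ : ℕ → ℝ) (y : Σ i, negG 𝒜 i) (B : List (Σ i, negG 𝒜 i)) :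
    ψ (y :: B).length • (𝐐 G) (y :: B)
      = ψ (B.length + 1) • l2Tw (Gerstenhaber.unitExt G) y.1 (homogVal y) ((𝐍 G) B)
        + ψ (B.length + 1) • sg y.1 • (Gerstenhaber.unitExt G).wedge (homogVal y) ((𝐐 G) B) := by
  rw [lList_cons homogVal_mem G.unitExt_hasUnit, smul_add, List.length_cons]

variable [DirectSum.Decomposition (negG 𝒜)]

lemma isRepresentedBy_lFormsG (k : ℕ) : IsRepresentedBy (lFormsG G (negG 𝒜) k) (𝐐 G) := by
  intro d x
  match k with
  | 0 => rw [lList_eq_zero _ (by simp)]; rfl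
  | 1 => rw [lList_eq_zero _ (by simp)]; rfl
  | 2 =>
    refine (isRepresentedBy_l2G G d x).trans ?_
    have h : homogList d x = [⟨d 0, x 0⟩, ⟨d 1, x 1⟩] := by simp [homogList, List.ofFn_succ]
    rw [h]
    simp [lList, splitSum, brList, wedgeList, G.unitExt_hasUnit.wedge_unit]
  | k + 3 =>
    refine (castForm_insertionOp 1 (isRepresentedBy_l2G G) (isRepresentedBy_mathcalN G (k + 1))
      (by omega) (by omega) d x).trans ?_
    refine splitSum_congr fun A B _ => ?_
    split_ifs with h
    · rw [wedgeList, homogVal_homogPrj (brList_mem homogVal_mem A) (fst_brList G A)]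
    · rw [brList_eq_zero h]; simp

lemma isRepresentedBy_smul_lFormsG {ψ : ℕ → ℝ} (k : ℕ) :
    IsRepresentedBy (ψ k • lFormsG G (negG 𝒜) k) (fun A => ψ A.length • (𝐐 G) A) := by
  intro d x
  beta_reduce
  rw [length_homogList, ← isRepresentedBy_lFormsG]
  simp

lemma homogVal_homogPrj_smul_wedgeList (φ : ℕ → ℝ) (A : List (Σ i, negG 𝒜 i)) :
    homogVal (homogPrj 0 A ((if A.length = 0 then 0 else φ A.length) • (𝐍 G) A).2)
      = (if A.length = 0 then 0 else φ A.length) • (𝐍 G) A := by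
  refine homogVal_homogPrj (Submodule.smul_mem _ _ ?_) ?_
  · rw [add_zero]; exact wedgeList_mem homogVal_mem G.unitExt_hasUnit A
  · cases A with
    | nil => simp
    | cons x A => simp [fst_wedgeList]

lemma homogVal_homogPrj_smul_lList (c : ℝ) (A : List (Σ i, negG 𝒜 i)) :
    homogVal (homogPrj 1 A (c • (𝐐 G) A).2) = c • (𝐐 G) A :=
  homogVal_homogPrj (Submodule.smul_mem _ _ (lList_mem homogVal_mem G.unitExt_hasUnit A))
    (by simp [fst_lList])

theorem exists_rnBracketM_mathcalN_lFormsG (φ ψ : ℕ → ℝ) :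
    ∃ χ : ℕ → ℝ, rnBracketM (negG 𝒜) 0 1 (fun k => φ k • mathcalN G (negG 𝒜) k)
      (fun k => ψ k • lFormsG G (negG 𝒜) k) = fun k => χ k • lFormsG G (negG 𝒜) k := by
  have hv := homogVal_mem (𝒜 := 𝒜)
  have he := G.unitExt_hasUnit
  suffices h : ∀ n : ℕ, ∃ c : ℝ, ∀ d x, ((0 : ℝ), rnBracketM (negG 𝒜) 0 1
      (fun k => φ k • mathcalN G (negG 𝒜) k) (fun k => ψ k • lFormsG G (negG 𝒜) k) n d x)
      = c • (𝐐 G) (homogList d x) by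
    choose χ hχ using h
    refine ⟨χ, funext fun n => funext fun d => funext fun x => ?_⟩
    have h1 := hχ n d x
    rw [← isRepresentedBy_lFormsG] at h1
    simpa using congrArg Prod.snd h1
  intro n
  set φ' : ℕ → ℝ := fun k => if k = 0 then 0 else φ k with hφ'
  let ω : ℕ → ℝ := fun k => φ' k * ψ (n + 1 - k)
  let ω' : ℕ → ℝ := fun k => ψ k * φ' (n + 1 - k)
  refine ⟨2 * binomWeight (fun k => ω (n - (k + 2) + 1)) (n - 2)
    + binomWeight (fun k => ω (n - (k + 2))) (n - 2)
    - binomWeight (fun k => ω' (k + 2)) (n - 2), fun d x => ?_⟩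
  have h1 := splitSum_l2Tw_wedgeList_wedgeList hv he ω (homogList d x)
  have h2 := splitSum_wedgeList_lList hv he ω (homogList d x)
  have h3 := splitSum_lList_wedgeList hv he ω' (homogList d x)
  rw [length_homogList] at h1 h2 h3
  rw [sub_smul, add_smul, ← h1, ← h2, ← h3, ← splitSum_add]
  have e1 := sum_castForm_insertionOp (𝒢 := negG 𝒜) (n := n) 0
    (isRepresentedBy_smul_mathcalN G (φ := φ)) (isRepresentedBy_smul_lFormsG G (ψ := ψ))
    (fun p => by have := Finset.mem_range.mp p.2; omega) d x
  have e2 := sum_castForm_insertionOp (𝒢 := negG 𝒜) (n := n) 1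
    (isRepresentedBy_smul_lFormsG G (ψ := ψ)) (isRepresentedBy_smul_mathcalN G (φ := φ))
    (fun p => by have := Finset.mem_range.mp p.2; omega) d x
  have e3 : ∀ K L : GForm (negG 𝒜) n, ((0 : ℝ), (K - ((-1 : ℤ) ^ ((0 : ℤ) * 1).natAbs) • L) d x)
      = ((0 : ℝ), K d x) - ((0 : ℝ), L d x) := fun K L => by simp
  rw [rnBracketM, e3, e1, e2]
  congr 1
  · refine splitSum_congr fun A B hAB => ?_
    rw [length_homogList] at hAB
    rw [smul_lList_cons, homogVal_homogPrj_smul_wedgeList]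
    simp only [homogPrj, add_zero, map_smul, LinearMap.smul_apply, smul_smul]
    rw [show B.length + 1 = n + 1 - A.length by omega]
    congr 2 <;> simp only [ω, hφ'] <;> ring
  · refine splitSum_congr fun A B hAB => ?_
    rw [length_homogList] at hAB
    rw [wedgeList, homogVal_homogPrj_smul_lList, List.length_cons]
    simp only [map_smul, LinearMap.smul_apply, smul_smul]
    rw [show B.length + 1 = n + 1 - A.length by omega]
    congr 1
    simp only [ω', hφ']; ring

theorem rnBracketM_lFormsG_lFormsG (φ ψ : ℕ → ℝ) :
    rnBracketM (negG 𝒜) 1 1 (fun k => φ k • lFormsG G (negG 𝒜) k)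
      (fun k => ψ k • lFormsG G (negG 𝒜) k) = 0 := by
  have hv := homogVal_mem (𝒜 := 𝒜)
  have he := G.unitExt_hasUnit
  have key : ∀ (φ ψ : ℕ → ℝ) (n : ℕ), (∑ p ∈ (Finset.range (n + 2)).attach,
      castForm (by have := Finset.mem_range.mp p.2; omega) (insertionOp (negG 𝒜) 1
        (φ p.1 • lFormsG G (negG 𝒜) p.1)
        (ψ (n + 1 - p.1) • lFormsG G (negG 𝒜) (n + 1 - p.1)))) = (0 : GForm (negG 𝒜) n) := by
    intro φ ψ n
    refine funext fun d => funext fun x => ?_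
    have e := sum_castForm_insertionOp (𝒢 := negG 𝒜) (n := n) 1
      (isRepresentedBy_smul_lFormsG G (ψ := φ)) (isRepresentedBy_smul_lFormsG G (ψ := ψ))
      (fun p => by have := Finset.mem_range.mp p.2; omega) d x
    refine congrArg Prod.snd (e.trans (c := (0 : ℝ × V)) ?_)
    let ω : ℕ → ℝ := fun k => φ k * ψ (n + 1 - k)
    have h1 := splitSum_l2Tw_lList_wedgeList hv he ω (homogList d x)
    have h2 := splitSum_lList_lList hv he (fun k => -ω k) (homogList d x)
    rw [← add_zero (0 : ℝ × V)]
    nth_rw 1 [← h1]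
    rw [← h2, ← splitSum_add]
    refine splitSum_congr fun A B hAB => ?_
    rw [length_homogList] at hAB
    rw [smul_lList_cons, homogVal_homogPrj_smul_lList]
    simp only [homogPrj, map_smul, LinearMap.smul_apply, smul_smul]
    rw [show B.length + 1 = n + 1 - A.length by omega, sg_add,
      show sg 1 = -1 by simp [sg]]
    congr 2 <;> simp only [ω] <;> ring
  funext n
  rw [rnBracketM, key, key]
  simp

end WeakNijenhuis

/-- For any real coefficients `(b_i)` and `(a_i)`, the form
`𝒩 = Σ_{i≥1} b_i 𝒩_i` is weak Nijenhuis with respect to `μ = Σ_{i≥1} a_i l_i`, i.e.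
`[μ, [𝒩, [𝒩, μ]_RN]_RN]_RN = 0`. -/
theorem nijenhuis_sum_weak
    {V : Type*} [AddCommGroup V] [Module ℝ V] {𝒜 : ℤ → Submodule ℝ V}
    (G : Gerstenhaber 𝒜) [DirectSum.Decomposition (negG 𝒜)]
    (a b : ℕ → ℝ) :
    rnBracketM (negG 𝒜) 1 1 (fun k => a k • lFormsG G (negG 𝒜) k)
      (rnBracketM (negG 𝒜) 0 1 (fun k => b k • mathcalN G (negG 𝒜) k)
        (rnBracketM (negG 𝒜) 0 1 (fun k => b k • mathcalN G (negG 𝒜) k)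
          (fun k => a k • lFormsG G (negG 𝒜) k))) = 0 := by
  obtain ⟨χ, hχ⟩ := exists_rnBracketM_mathcalN_lFormsG G b a
  obtain ⟨χ', hχ'⟩ := exists_rnBracketM_mathcalN_lFormsG G b χ
  rw [hχ, hχ']
  exact rnBracketM_lFormsG_lFormsG G a χ'
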